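/- Under the stochastic setting and the RGE definition, for every x ∈ ℝ^d the random gradient estimator satisfies E‖G_r(x) − ∇f(x)‖² ≤ (2/b_r)(1 + d/n_r)(‖∇f(x)‖² + σ²) + (1 + 2/b_r + 2/(n_r b_r)) · μ_r² L² d² / 4. -/

import Mathlib

open MeasureTheory Finset
open scoped RealInnerProductSpace ENNReal

noncomputable section

/-- Euclidean space `ℝ^d`. -/
abbrev Euc (d : ℕ) := EuclideanSpace ℝ (Fin d)

/-- `g : ℝ^d → ℝ` is `L`-smooth: differentiable with `L`-Lipschitz gradient. -/
def LSmooth {d : ℕ} (g : Euc d → ℝ) (L : ℝ) : Prop :=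
  Differentiable ℝ g ∧ ∀ x y, ‖gradient g x - gradient g y‖ ≤ L * ‖x - y‖

/-- The uniform probability distribution on the unit sphere of `ℝ^d`, realized as the
pushforward of the normalized Lebesgue measure on the unit ball under radial projection. -/
def sphereUniform (d : ℕ) : Measure (Euc d) :=
  Measure.map (fun x => ‖x‖⁻¹ • x)
    ((volume (Metric.ball (0 : Euc d) 1))⁻¹ • volume.restrict (Metric.ball (0 : Euc d) 1))

/-- Sample space measure for the RGE: `b_r` i.i.d. data samples from `P` together with
`b_r × n_r` i.i.d. uniform directions on the unit sphere, all independent. -/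
def RGEmeas (d : ℕ) {Ω : Type} [MeasurableSpace Ω] (P : Measure Ω) (nr br : ℕ) :
    Measure ((Fin br → Ω) × (Fin br → Fin nr → Euc d)) :=
  (Measure.pi fun _ => P).prod (Measure.pi fun _ => Measure.pi fun _ => sphereUniform d)

/-- The random gradient estimator (RGE) at `x`, as a function of the sampled
data batch `ω.1` and sampled random directions `ω.2`. -/
def RGE {d : ℕ} {Ω : Type} (F : Euc d → Ω → ℝ) (μr : ℝ) (nr br : ℕ)
    (x : Euc d) (ω : (Fin br → Ω) × (Fin br → Fin nr → Euc d)) : Euc d :=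
  (br : ℝ)⁻¹ • ∑ j : Fin br, (nr : ℝ)⁻¹ • ∑ i : Fin nr,
    (((d : ℝ) / μr) * (F (x + μr • ω.2 j i) (ω.1 j) - F x (ω.1 j))) • ω.2 j i

/-- Bernoulli measure on `Bool` with success probability `p`. -/
def bern (p : ℝ) : Measure Bool :=
  ENNReal.ofReal p • Measure.dirac true + ENNReal.ofReal (1 - p) • Measure.dirac false

/-- Sample space measure for the CGE: independent Bernoulli coordinate-selection variables
`Z_i ~ Bern(p_i)` together with an independent i.i.d. data batch of size `b_c` from `P`. -/
def CGEmeas (d : ℕ) {Ω : Type} [MeasurableSpace Ω] (P : Measure Ω) (bc : ℕ) (p : Fin d → ℝ) :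
    Measure ((Fin d → Bool) × (Fin bc → Ω)) :=
  (Measure.pi fun i => bern (p i)).prod (Measure.pi fun _ => P)

/-- The importance-sampled coordinate-wise gradient estimator (CGE) at `x`, with
coordinate smoothing parameters `μc i`, selection probabilities `p i`, coordinate
indicators `ω.1` and data batch `ω.2`. -/
def CGE {d : ℕ} {Ω : Type} (F : Euc d → Ω → ℝ) (μc : Fin d → ℝ) (bc : ℕ) (p : Fin d → ℝ)
    (x : Euc d) (ω : (Fin d → Bool) × (Fin bc → Ω)) : Euc d :=
  ∑ i : Fin d, (((if ω.1 i then (1:ℝ) else 0) / p i) * ((bc : ℝ)⁻¹ *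
      ∑ j : Fin bc, (F (x + μc i • EuclideanSpace.single i (1:ℝ)) (ω.2 j)
        - F (x - μc i • EuclideanSpace.single i (1:ℝ)) (ω.2 j)) / (2 * μc i))) •
    EuclideanSpace.single i (1:ℝ)

lemma LSmooth.abs_sub_sub_inner_le {d : ℕ} {g : Euc d → ℝ} {L : ℝ} (hg : LSmooth g L)
    (x v : Euc d) :
    |g (x + v) - g x - ⟪gradient g x, v⟫| ≤ L * ‖v‖ ^ 2 / 2 := by
  have hderiv (t : ℝ) : HasDerivAt (fun s : ℝ => g (x + s • v) - g x - s * ⟪gradient g x, v⟫)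
      (⟪gradient g (x + t • v), v⟫ - ⟪gradient g x, v⟫) t := by
    have hline : HasDerivAt (fun s : ℝ => x + s • v) v t := by
      simpa using ((hasDerivAt_id t).smul_const v).const_add x
    have hcomp := (hg.1 (x + t • v)).hasGradientAt.hasFDerivAt.comp_hasDerivAt t hline
    have hlin := (hasDerivAt_id t).mul_const ⟪gradient g x, v⟫
    rw [one_mul] at hlin
    rw [InnerProductSpace.toDual_apply_apply] at hcomp
    exact (hcomp.sub_const (g x)).sub hlin
  have hbound := image_norm_le_of_norm_deriv_right_le_deriv_boundary
    (f := fun s : ℝ => g (x + s • v) - g x - s * ⟪gradient g x, v⟫) (a := 0) (b := 1)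
    (B := fun s => L * ‖v‖ ^ 2 * s ^ 2 / 2) (B' := fun s => L * ‖v‖ ^ 2 * s)
    (fun s _ => (hderiv s).continuousAt.continuousWithinAt)
    (fun s _ => (hderiv s).hasDerivWithinAt) (by simp)
    (fun s => by
      have := ((hasDerivAt_pow 2 s).const_mul (L * ‖v‖ ^ 2)).div_const 2
      exact this.congr_deriv (by norm_num; ring))
    (fun s hs => by
      rw [← inner_sub_left]
      calc ‖⟪gradient g (x + s • v) - gradient g x, v⟫‖
          ≤ ‖gradient g (x + s • v) - gradient g x‖ * ‖v‖ := norm_inner_le_norm _ _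
        _ ≤ (L * ‖(x + s • v) - x‖) * ‖v‖ := by gcongr; exact hg.2 _ _
        _ = L * ‖v‖ ^ 2 * s := by
          rw [add_sub_cancel_left, norm_smul, Real.norm_of_nonneg hs.1]; ring)
    (Set.right_mem_Icc.2 zero_le_one)
  simpa using hbound

lemma measurable_radial (d : ℕ) : Measurable (fun x : Euc d => ‖x‖⁻¹ • x) := by
  fun_prop

lemma volume_unitBall_pos (d : ℕ) : 0 < volume (Metric.ball (0 : Euc d) 1) :=
  Metric.measure_ball_pos _ _ one_pos

instance isProbabilityMeasure_sphereUniform (d : ℕ) : IsProbabilityMeasure (sphereUniform d) := by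
  unfold sphereUniform
  have : IsProbabilityMeasure ((volume (Metric.ball (0 : Euc d) 1))⁻¹ •
      volume.restrict (Metric.ball (0 : Euc d) 1)) := by
    constructor
    simp only [Measure.smul_apply, Measure.restrict_apply_univ, smul_eq_mul]
    exact ENNReal.inv_mul_cancel (volume_unitBall_pos d).ne' measure_ball_lt_top.ne
  exact Measure.isProbabilityMeasure_map (measurable_radial d).aemeasurable

lemma ae_norm_eq_one_sphereUniform {d : ℕ} (hd : 1 ≤ d) : ∀ᵐ u ∂sphereUniform d, ‖u‖ = 1 := by
  have : Nonempty (Fin d) := ⟨⟨0, hd⟩⟩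
  rw [sphereUniform, ae_map_iff (measurable_radial d).aemeasurable
    (measurableSet_eq_fun (by fun_prop) (by fun_prop))]
  refine Measure.ae_smul_measure (ae_restrict_of_ae ?_) _
  filter_upwards [Measure.ae_ne volume (0 : Euc d)] with x hx
  rw [norm_smul, norm_inv, norm_norm, inv_mul_cancel₀ (norm_ne_zero_iff.2 hx)]

lemma measurePreserving_sphereUniform {d : ℕ} (T : Euc d ≃ₗᵢ[ℝ] Euc d) :
    MeasurePreserving T (sphereUniform d) (sphereUniform d) := by
  have hball : T ⁻¹' Metric.ball (0 : Euc d) 1 = Metric.ball 0 1 := by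
    ext; simp
  have hT : MeasurePreserving T
      ((volume (Metric.ball (0 : Euc d) 1))⁻¹ • volume.restrict (Metric.ball (0 : Euc d) 1))
      ((volume (Metric.ball (0 : Euc d) 1))⁻¹ • volume.restrict (Metric.ball (0 : Euc d) 1)) := by
    have := T.measurePreserving.restrict_preimage 
      (measurableSet_ball (x := (0 : Euc d)) (ε := 1))
    rw [hball] at this
    exact this.smul_measure _
  refine ⟨T.continuous.measurable, ?_⟩
  unfold sphereUniform
  rw [Measure.map_map T.continuous.measurable (measurable_radial d)]
  conv_rhs => rw [← hT.map_eq]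
  rw [Measure.map_map (measurable_radial d) T.continuous.measurable]
  congr 1
  ext1 y
  simp

lemma integrable_of_norm_le_sphereUniform {d : ℕ} (hd : 1 ≤ d) {E : Type*} [NormedAddCommGroup E]
    {φ : Euc d → E} (hφ : AEStronglyMeasurable φ (sphereUniform d)) (C : ℝ)
    (hC : ∀ u, ‖u‖ = 1 → ‖φ u‖ ≤ C) : Integrable φ (sphereUniform d) :=
  Integrable.of_bound hφ C ((ae_norm_eq_one_sphereUniform hd).mono hC)

lemma integrable_inner_sq_sphereUniform {d : ℕ} (hd : 1 ≤ d) (v : Euc d) :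
    Integrable (fun u => ⟪v, u⟫ ^ 2) (sphereUniform d) := by
  refine integrable_of_norm_le_sphereUniform hd (by fun_prop) (‖v‖ ^ 2) fun u hu => ?_
  rw [norm_pow]
  gcongr
  simpa [hu] using norm_inner_le_norm (𝕜 := ℝ) v u

lemma integral_inner_sq_sphereUniform {d : ℕ} (hd : 1 ≤ d) (a : Euc d) :
    ∫ u, ⟪a, u⟫ ^ 2 ∂sphereUniform d = ‖a‖ ^ 2 / d := by
  have hd0 : (d : ℝ) ≠ 0 := by positivity
  have hinv (v w : Euc d) (h : ‖v‖ = ‖w‖) :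
      ∫ u, ⟪v, u⟫ ^ 2 ∂sphereUniform d = ∫ u, ⟪w, u⟫ ^ 2 ∂sphereUniform d := by
    set T := (ℝ ∙ (v - w))ᗮ.reflection
    have hT : T v = w := Submodule.reflection_sub h
    rw [← (measurePreserving_sphereUniform T).integral_comp T.toHomeomorph.measurableEmbedding
      (fun u => ⟪w, u⟫ ^ 2), ← hT]
    simp only [LinearIsometryEquiv.inner_map_map]
  have hbasis : ∑ i, ∫ u, ⟪EuclideanSpace.single i (‖a‖ : ℝ), u⟫ ^ 2 ∂sphereUniform d
      = ‖a‖ ^ 2 := by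
    rw [← integral_finsetSum _ fun i _ => integrable_inner_sq_sphereUniform hd _]
    have : ∀ᵐ u ∂sphereUniform d,
        ∑ i, ⟪EuclideanSpace.single i (‖a‖ : ℝ), u⟫ ^ 2 = ‖a‖ ^ 2 := by
      filter_upwards [ae_norm_eq_one_sphereUniform hd] with u hu
      have : ∑ i, u i ^ 2 = 1 := by rw [← EuclideanSpace.real_norm_sq_eq, hu, one_pow]
      simp [EuclideanSpace.inner_single_left, mul_pow, ← Finset.mul_sum, this]
    rw [integral_congr_ae this]
    simp
  have hsame (i : Fin d) : ∫ u, ⟪EuclideanSpace.single i (‖a‖ : ℝ), u⟫ ^ 2 ∂sphereUniform d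
      = ∫ u, ⟪a, u⟫ ^ 2 ∂sphereUniform d := hinv _ _ (by simp)
  simp only [hsame, sum_const, card_univ, Fintype.card_fin, nsmul_eq_mul] at hbasis
  rw [← hbasis]
  field_simp

lemma integral_inner_smul_sphereUniform {d : ℕ} (hd : 1 ≤ d) (a : Euc d) :
    ∫ u, ((d : ℝ) * ⟪a, u⟫) • u ∂sphereUniform d = a := by
  have hd0 : (d : ℝ) ≠ 0 := by positivity
  have hInt : Integrable (fun u => ((d : ℝ) * ⟪a, u⟫) • u) (sphereUniform d) := by
    refine integrable_of_norm_le_sphereUniform hd (by fun_prop) (d * ‖a‖) fun u hu => ?_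
    rw [norm_smul, hu, mul_one, norm_mul, Real.norm_natCast]
    gcongr
    simpa [hu] using norm_inner_le_norm (𝕜 := ℝ) a u
  refine ext_inner_left ℝ fun b => ?_
  rw [← integral_inner hInt]
  have : ∀ u, ⟪b, ((d : ℝ) * ⟪a, u⟫) • u⟫
      = (d / 4 : ℝ) * (⟪a + b, u⟫ ^ 2 - ⟪a - b, u⟫ ^ 2) := by
    intro u
    rw [real_inner_smul_right, inner_add_left, inner_sub_left]
    ring
  simp only [this]
  rw [integral_const_mul, integral_sub (integrable_inner_sq_sphereUniform hd _)
    (integrable_inner_sq_sphereUniform hd _), integral_inner_sq_sphereUniform hd,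
    integral_inner_sq_sphereUniform hd, norm_add_sq_real, norm_sub_sq_real, real_inner_comm]
  field_simp
  ring

lemma integral_sq_mean_sub_le {Z : Type*} [MeasurableSpace Z] (ν : Measure Z)
    [IsProbabilityMeasure ν] {m : ℕ} (hm : 1 ≤ m) {X : Z → ℝ} (hX : MemLp X 2 ν) (c : ℝ) :
    ∫ z, ((m : ℝ)⁻¹ * ∑ j, X (z j) - c) ^ 2 ∂Measure.pi (fun _ : Fin m => ν)
      ≤ (m : ℝ)⁻¹ * ∫ z, X z ^ 2 ∂ν + (∫ z, X z ∂ν - c) ^ 2 := by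
  have hm0 : (m : ℝ) ≠ 0 := by positivity
  have hXj (j : Fin m) : MemLp (fun z : Fin m → Z => X (z j)) 2 (Measure.pi fun _ => ν) :=
    hX.comp_measurePreserving (measurePreserving_eval _ j)
  have hmean (j : Fin m) : ∫ z, X (z j) ∂Measure.pi (fun _ : Fin m => ν) = ∫ z, X z ∂ν :=
    integral_comp_eval (μ := fun _ => ν) hX.aestronglyMeasurable
  set S : (Fin m → Z) → ℝ := ∑ j, fun z => X (z j) with hS
  have hSm : MemLp S 2 (Measure.pi fun _ => ν) := memLp_finsetSum' _ fun j _ => hXj j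
  have hSvar : ProbabilityTheory.variance S (Measure.pi fun _ => ν)
      = m * ProbabilityTheory.variance X ν := by
    rw [hS, ProbabilityTheory.variance_sum_pi (X := fun _ => X) fun _ => hX]
    simp
  have hSmean : ∫ z, S z ∂Measure.pi (fun _ : Fin m => ν) = m * ∫ z, X z ∂ν := by
    simp only [hS, Finset.sum_apply]
    rw [integral_finsetSum _ fun j _ => (hXj j).integrable one_le_two]
    simp [hmean]
  rw [ProbabilityTheory.variance_eq_sub hSm, hSmean, ProbabilityTheory.variance_eq_sub hX] at hSvar
  simp only [Pi.pow_apply] at hSvar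
  have hexp : ∀ z : Fin m → Z, ((m : ℝ)⁻¹ * ∑ j, X (z j) - c) ^ 2
      = (m : ℝ)⁻¹ ^ 2 * S z ^ 2 - 2 * (m : ℝ)⁻¹ * c * S z + c ^ 2 := by
    intro z
    simp only [hS, Finset.sum_apply]
    ring
  simp only [hexp]
  have h1 : Integrable (fun z => (m : ℝ)⁻¹ ^ 2 * S z ^ 2) (Measure.pi fun _ => ν) :=
    hSm.integrable_sq.const_mul _
  have h2 : Integrable (fun z => 2 * (m : ℝ)⁻¹ * c * S z) (Measure.pi fun _ => ν) :=
    (hSm.integrable one_le_two).const_mul _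
  rw [integral_add (by exact h1.sub h2) (integrable_const _), integral_sub h1 h2, integral_const_mul,
    integral_const_mul, hSmean, eq_add_of_sub_eq hSvar]
  simp only [integral_const, probReal_univ, smul_eq_mul, one_mul]
  have hnn : 0 ≤ (m : ℝ)⁻¹ * (∫ z, X z ∂ν) ^ 2 := by positivity
  refine le_of_sub_nonneg (hnn.trans_eq ?_)
  field_simp
  ring

lemma integral_norm_sq_mean_sub_le {d : ℕ} {Z : Type*} [MeasurableSpace Z] (ν : Measure Z)
    [IsProbabilityMeasure ν] {m : ℕ} (hm : 1 ≤ m) {g : Z → Euc d} (hg : MemLp g 2 ν) (c : Euc d) :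
    ∫ z, ‖(m : ℝ)⁻¹ • ∑ j, g (z j) - c‖ ^ 2 ∂Measure.pi (fun _ : Fin m => ν)
      ≤ (m : ℝ)⁻¹ * ∫ z, ‖g z‖ ^ 2 ∂ν + ‖∫ z, g z ∂ν - c‖ ^ 2 := by
  have hgk (k : Fin d) : MemLp (fun z => g z k) 2 ν := hg.eval_piLp k
  have hmean (k : Fin d) : (∫ z, g z ∂ν) k = ∫ z, g z k ∂ν :=
    eval_integral_piLp (fun i => (hgk i).integrable one_le_two) k
  simp only [EuclideanSpace.real_norm_sq_eq, PiLp.sub_apply, PiLp.smul_apply, smul_eq_mul, hmean,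
    WithLp.ofLp_sum, Finset.sum_apply]
  rw [integral_finsetSum, integral_finsetSum, Finset.mul_sum, ← Finset.sum_add_distrib]
  · exact Finset.sum_le_sum fun k _ => integral_sq_mean_sub_le ν hm (hgk k) (c k)
  · exact fun k _ => (hgk k).integrable_sq
  · intro k _
    have hj (j : Fin m) : MemLp (fun z : Fin m → Z => g (z j) k) 2 (Measure.pi fun _ => ν) :=
      (hgk k).comp_measurePreserving (measurePreserving_eval _ j)
    have hs := (memLp_finsetSum univ fun j _ => hj j).const_mul (m : ℝ)⁻¹
    exact (hs.sub (memLp_const (c k))).integrable_sq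

lemma memLp_of_memLp_sum_pi {E : Type*} [NormedAddCommGroup E] {Z : Type*} [MeasurableSpace Z]
    (ν : Measure Z) [IsProbabilityMeasure ν] {m : ℕ} (hm : 1 ≤ m) {g : Z → E}
    (hg : AEStronglyMeasurable g ν)
    (hsum : MemLp (fun z => ∑ j, g (z j)) 2 (Measure.pi fun _ : Fin m => ν)) : MemLp g 2 ν := by
  obtain ⟨n, rfl⟩ := Nat.exists_eq_add_of_le' hm
  have hmp := (measurePreserving_piFinSuccAbove (fun _ : Fin (n + 1) => ν) 0).symm
  have hprod := hsum.comp_measurePreserving hmp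
  have hInt := (hprod.integrable_norm_pow two_ne_zero).prod_left_ae
  obtain ⟨y, hy⟩ := hInt.exists
  have hrest : MemLp (fun z => g z + ∑ j, g (y j)) 2 ν := by
    refine (memLp_two_iff_integrable_sq_norm (hg.add aestronglyMeasurable_const)).2 ?_
    simpa [Function.comp_def, Fin.sum_univ_succ, MeasurableEquiv.piFinSuccAbove] using hy
  have hsub := hrest.sub (memLp_const (∑ j, g (y j)))
  exact hsub.congr_norm hg (.of_forall fun z => by simp)

lemma norm_integral_sq_le {d : ℕ} {Z : Type*} [MeasurableSpace Z] (ν : Measure Z)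
    [IsProbabilityMeasure ν] {g : Z → Euc d} (hg : MemLp g 2 ν) :
    ‖∫ z, g z ∂ν‖ ^ 2 ≤ ∫ z, ‖g z‖ ^ 2 ∂ν := by
  have hn := ProbabilityTheory.variance_nonneg (fun z => ‖g z‖) ν
  rw [ProbabilityTheory.variance_eq_sub hg.norm] at hn
  have h1 : ‖∫ z, g z ∂ν‖ ^ 2 ≤ (∫ z, ‖g z‖ ∂ν) ^ 2 := by
    gcongr
    exact norm_integral_le_integral_norm _
  simp only [Pi.pow_apply] at hn
  linarith

/-- The single-sample random gradient estimator built from one realization `h` of the objective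
and `n` directions `u`. -/
def sampleRGE {d : ℕ} (h : Euc d → ℝ) (μr : ℝ) (n : ℕ) (x : Euc d) (u : Fin n → Euc d) : Euc d :=
  (n : ℝ)⁻¹ • ∑ i, (((d : ℝ) / μr) * (h (x + μr • u i) - h x)) • u i

/-- The limit of `sampleRGE` as the smoothing parameter vanishes, for a function with
gradient `a`. -/
def linearRGE {d : ℕ} (n : ℕ) (a : Euc d) (u : Fin n → Euc d) : Euc d :=
  (n : ℝ)⁻¹ • ∑ i, ((d : ℝ) * ⟪a, u i⟫) • u i

lemma ae_pi_norm_eq_one {d : ℕ} (hd : 1 ≤ d) (n : ℕ) :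
    ∀ᵐ u ∂Measure.pi (fun _ : Fin n => sphereUniform d), ∀ i, ‖u i‖ = 1 :=
  ae_all_iff.2 fun i =>
    (measurePreserving_eval (fun _ : Fin n => sphereUniform d) i).quasiMeasurePreserving.ae
      (ae_norm_eq_one_sphereUniform hd)

lemma norm_mean_le {E : Type*} [NormedAddCommGroup E] [NormedSpace ℝ E] {n : ℕ} (hn : 1 ≤ n)
    {v : Fin n → E} {C : ℝ} (hv : ∀ i, ‖v i‖ ≤ C) : ‖(n : ℝ)⁻¹ • ∑ i, v i‖ ≤ C := by
  have hn0 : (0 : ℝ) < n := by positivity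
  rw [norm_smul, norm_inv, Real.norm_natCast, inv_mul_le_iff₀ hn0]
  simpa using norm_sum_le_of_le univ fun i _ => hv i

lemma norm_mul_inner_smul_le {d : ℕ} (a : Euc d) {u : Euc d} (hu : ‖u‖ = 1) :
    ‖((d : ℝ) * ⟪a, u⟫) • u‖ ≤ d * ‖a‖ := by
  rw [norm_smul, hu, mul_one, norm_mul, Real.norm_natCast]
  gcongr
  simpa [hu] using norm_inner_le_norm (𝕜 := ℝ) a u

lemma norm_linearRGE_le {d n : ℕ} (hn : 1 ≤ n) (a : Euc d) {u : Fin n → Euc d}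
    (hu : ∀ i, ‖u i‖ = 1) : ‖linearRGE n a u‖ ≤ d * ‖a‖ :=
  norm_mean_le hn fun i => norm_mul_inner_smul_le a (hu i)

lemma norm_sampleRGE_sub_linearRGE_le {d n : ℕ} (hn : 1 ≤ n) {h : Euc d → ℝ} {L : ℝ}
    (hh : LSmooth h L) {μr : ℝ} (hμr : 0 < μr) (x : Euc d) {u : Fin n → Euc d}
    (hu : ∀ i, ‖u i‖ = 1) :
    ‖sampleRGE h μr n x u - linearRGE n (gradient h x) u‖ ≤ μr * L * d / 2 := by
  rw [sampleRGE, linearRGE, ← smul_sub, ← Finset.sum_sub_distrib]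
  refine norm_mean_le hn fun i => ?_
  have hres := hh.abs_sub_sub_inner_le x (μr • u i)
  rw [norm_smul, hu i, Real.norm_of_nonneg hμr.le, real_inner_smul_right] at hres
  have heq : (d : ℝ) / μr * (h (x + μr • u i) - h x) - d * ⟪gradient h x, u i⟫
      = d / μr * (h (x + μr • u i) - h x - μr * ⟪gradient h x, u i⟫) := by
    field_simp
  rw [← sub_smul, heq, norm_smul, hu i, mul_one, norm_mul, Real.norm_eq_abs, Real.norm_eq_abs,
    abs_of_nonneg (by positivity : (0 : ℝ) ≤ d / μr)]
  calc (d : ℝ) / μr * |h (x + μr • u i) - h x - μr * ⟪gradient h x, u i⟫|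
      ≤ d / μr * (L * (μr * 1) ^ 2 / 2) := by gcongr
    _ = μr * L * d / 2 := by field_simp

lemma memLp_mul_inner_smul_sphereUniform {d : ℕ} (hd : 1 ≤ d) (a : Euc d) :
    MemLp (fun u => ((d : ℝ) * ⟪a, u⟫) • u) 2 (sphereUniform d) :=
  MemLp.of_bound (by fun_prop) (d * ‖a‖)
    ((ae_norm_eq_one_sphereUniform hd).mono fun _ hu => norm_mul_inner_smul_le a hu)

lemma memLp_linearRGE {d n : ℕ} (hd : 1 ≤ d) (hn : 1 ≤ n) (a : Euc d) :
    MemLp (linearRGE n a) 2 (Measure.pi fun _ : Fin n => sphereUniform d) := by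
  refine MemLp.of_bound ?_ (d * ‖a‖)
    ((ae_pi_norm_eq_one hd n).mono fun _ hu => norm_linearRGE_le hn a hu)
  unfold linearRGE
  fun_prop

lemma integral_linearRGE {d n : ℕ} (hd : 1 ≤ d) (hn : 1 ≤ n) (a : Euc d) :
    ∫ u, linearRGE n a u ∂Measure.pi (fun _ : Fin n => sphereUniform d) = a := by
  have hn0 : (n : ℝ) ≠ 0 := by positivity
  have hℓ := memLp_mul_inner_smul_sphereUniform hd a
  have hmean (i : Fin n) : ∫ u, ((d : ℝ) * ⟪a, u i⟫) • u i
      ∂Measure.pi (fun _ : Fin n => sphereUniform d) = a :=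
    (integral_comp_eval (μ := fun _ => sphereUniform d) hℓ.aestronglyMeasurable).trans
      (integral_inner_smul_sphereUniform hd a)
  have hInt (i : Fin n) : Integrable (fun u : Fin n → Euc d => ((d : ℝ) * ⟪a, u i⟫) • u i)
      (Measure.pi fun _ => sphereUniform d) :=
    (hℓ.comp_measurePreserving (measurePreserving_eval _ i)).integrable one_le_two
  unfold linearRGE
  rw [integral_smul, integral_finsetSum _ fun i _ => hInt i]
  simp only [hmean, sum_const, card_univ, Fintype.card_fin]
  rw [← Nat.cast_smul_eq_nsmul ℝ, smul_smul, inv_mul_cancel₀ hn0, one_smul]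

lemma integral_norm_sq_linearRGE_le {d n : ℕ} (hd : 1 ≤ d) (hn : 1 ≤ n) (a : Euc d) :
    ∫ u, ‖linearRGE n a u‖ ^ 2 ∂Measure.pi (fun _ : Fin n => sphereUniform d)
      ≤ (1 + (d : ℝ) / n) * ‖a‖ ^ 2 := by
  have hd0 : (d : ℝ) ≠ 0 := by positivity
  have hsq : ∫ u, ‖((d : ℝ) * ⟪a, u⟫) • u‖ ^ 2 ∂sphereUniform d = d * ‖a‖ ^ 2 := by
    have : ∀ᵐ u ∂sphereUniform d,
        ‖((d : ℝ) * ⟪a, u⟫) • u‖ ^ 2 = (d : ℝ) ^ 2 * ⟪a, u⟫ ^ 2 := by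
      filter_upwards [ae_norm_eq_one_sphereUniform hd] with u hu
      rw [norm_smul, hu, mul_one, Real.norm_eq_abs, sq_abs, mul_pow]
    rw [integral_congr_ae this, integral_const_mul, integral_inner_sq_sphereUniform hd]
    field_simp
  have := integral_norm_sq_mean_sub_le (sphereUniform d) hn
    (memLp_mul_inner_smul_sphereUniform hd a) 0
  simp only [sub_zero, hsq, integral_inner_smul_sphereUniform hd] at this
  refine this.trans_eq ?_
  ring

lemma aestronglyMeasurable_linearRGE {d : ℕ} {Ω : Type*} [MeasurableSpace Ω] {P : Measure Ω}
    {a : Ω → Euc d} (ha : AEStronglyMeasurable a P) (n : ℕ) :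
    AEStronglyMeasurable (fun z : Ω × (Fin n → Euc d) => linearRGE n (a z.1) z.2)
      (P.prod (Measure.pi fun _ => sphereUniform d)) := by
  have ha' := ha.comp_fst (ν := Measure.pi fun _ : Fin n => sphereUniform d)
  have hu (i : Fin n) : AEStronglyMeasurable (fun z : Ω × (Fin n → Euc d) => z.2 i)
      (P.prod (Measure.pi fun _ => sphereUniform d)) :=
    Measurable.aestronglyMeasurable (by fun_prop)
  unfold linearRGE
  have hterm (i : Fin n) : AEStronglyMeasurable
      (fun z : Ω × (Fin n → Euc d) => ((d : ℝ) * ⟪a z.1, z.2 i⟫) • z.2 i)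
      (P.prod (Measure.pi fun _ => sphereUniform d)) :=
    ((ha'.inner (𝕜 := ℝ) (hu i)).const_mul (d : ℝ)).smul (hu i)
  exact (Finset.aestronglyMeasurable_fun_sum univ fun i _ => hterm i).const_smul (n : ℝ)⁻¹

lemma memLp_linearRGE_prod {d n : ℕ} (hd : 1 ≤ d) (hn : 1 ≤ n) {Ω : Type*} [MeasurableSpace Ω]
    {P : Measure Ω} [IsProbabilityMeasure P] {a : Ω → Euc d} (ha : MemLp a 2 P) :
    MemLp (fun z : Ω × (Fin n → Euc d) => linearRGE n (a z.1) z.2) 2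
      (P.prod (Measure.pi fun _ => sphereUniform d)) := by
  refine (ha.comp_fst (Measure.pi fun _ : Fin n => sphereUniform d)).of_le_mul
    (aestronglyMeasurable_linearRGE ha.aestronglyMeasurable n) (c := d) ?_
  filter_upwards [Measure.quasiMeasurePreserving_snd.ae (ae_pi_norm_eq_one hd n)] with z hz
  exact norm_linearRGE_le hn _ hz

lemma memLp_of_memLp_linearRGE {d n : ℕ} (hd : 1 ≤ d) (hn : 1 ≤ n) {Ω : Type*}
    [MeasurableSpace Ω] {P : Measure Ω} [IsProbabilityMeasure P] {a : Ω → Euc d}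
    (ha : AEStronglyMeasurable a P)
    (hlin : MemLp (fun z : Ω × (Fin n → Euc d) => linearRGE n (a z.1) z.2) 2
      (P.prod (Measure.pi fun _ => sphereUniform d))) : MemLp a 2 P := by
  refine (memLp_two_iff_integrable_sq_norm ha).2 ?_
  refine (hlin.integrable_norm_pow two_ne_zero).integral_prod_left.mono' (by fun_prop)
    (.of_forall fun ω => ?_)
  have := norm_integral_sq_le _ (memLp_linearRGE hd hn (a ω))
  rw [integral_linearRGE hd hn] at this
  simpa using this

lemma integral_linearRGE_prod {d n : ℕ} (hd : 1 ≤ d) (hn : 1 ≤ n) {Ω : Type*} [MeasurableSpace Ω]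
    {P : Measure Ω} [IsProbabilityMeasure P] {a : Ω → Euc d} (ha : MemLp a 2 P) :
    ∫ z : Ω × (Fin n → Euc d), linearRGE n (a z.1) z.2
      ∂(P.prod (Measure.pi fun _ => sphereUniform d)) = ∫ ω, a ω ∂P := by
  rw [integral_prod _ ((memLp_linearRGE_prod hd hn ha).integrable one_le_two)]
  simp only [integral_linearRGE hd hn]

lemma integral_norm_sq_linearRGE_prod_le {d n : ℕ} (hd : 1 ≤ d) (hn : 1 ≤ n) {Ω : Type*}
    [MeasurableSpace Ω] {P : Measure Ω} [IsProbabilityMeasure P] {a : Ω → Euc d}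
    (ha : MemLp a 2 P) :
    ∫ z : Ω × (Fin n → Euc d), ‖linearRGE n (a z.1) z.2‖ ^ 2
      ∂(P.prod (Measure.pi fun _ => sphereUniform d))
      ≤ (1 + (d : ℝ) / n) * ∫ ω, ‖a ω‖ ^ 2 ∂P := by
  have hInt := (memLp_linearRGE_prod hd hn ha).integrable_norm_pow two_ne_zero
  rw [integral_prod _ hInt, ← integral_const_mul]
  exact integral_mono hInt.integral_prod_left
    ((ha.integrable_norm_pow two_ne_zero).const_mul _)
    fun ω => integral_norm_sq_linearRGE_le hd hn (a ω)

lemma aestronglyMeasurable_gradient {d : ℕ} {Ω : Type*} [MeasurableSpace Ω] {P : Measure Ω}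
    {F : Euc d → Ω → ℝ} (hF : ∀ y, Measurable (F y)) (x : Euc d)
    (hdiff : ∀ᵐ ω ∂P, DifferentiableAt ℝ (fun y => F y ω) x) :
    AEStronglyMeasurable (fun ω => gradient (fun y => F y ω) x) P := by
  have hcoord (v : Euc d) :
      AEMeasurable (fun ω => ⟪gradient (fun y => F y ω) x, v⟫) P := by
    refine aemeasurable_of_tendsto_metrizable_ae Filter.atTop
      (f := fun (k : ℕ) ω => (k : ℝ) * (F (x + (k : ℝ)⁻¹ • v) ω - F x ω))
      (fun k => (((hF _).sub (hF _)).const_mul _).aemeasurable) ?_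
    filter_upwards [hdiff] with ω hω
    have hd' := hω.hasGradientAt.hasFDerivAt
    have := hd'.lim_real v
    simpa [Function.comp_def] using this.comp tendsto_natCast_atTop_atTop
  refine AEMeasurable.aestronglyMeasurable ?_
  have hpi : AEMeasurable (fun ω i => gradient (fun y => F y ω) x i) P :=
    aemeasurable_pi_lambda _ fun i => by
      refine (hcoord (EuclideanSpace.single i 1)).congr (.of_forall fun ω => ?_)
      simp only [EuclideanSpace.inner_single_right, one_mul, conj_trivial]
  exact (WithLp.measurable_toLp 2 _).comp_aemeasurable hpi

lemma integral_norm_sq_le_of_coord_variance_le {d : ℕ} {Ω : Type*} [MeasurableSpace Ω]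
    {P : Measure Ω} [IsProbabilityMeasure P] {a : Ω → Euc d} (ha : MemLp a 2 P) {ζ : ℝ}
    (hvar : ∀ i, ∫ ω, (a ω i - (∫ ω, a ω ∂P) i) ^ 2 ∂P ≤ ζ ^ 2) :
    ∫ ω, ‖a ω‖ ^ 2 ∂P ≤ ‖∫ ω, a ω ∂P‖ ^ 2 + d * ζ ^ 2 := by
  have hak (k : Fin d) : MemLp (fun ω => a ω k) 2 P := ha.eval_piLp k
  have hmean (k : Fin d) : (∫ ω, a ω ∂P) k = ∫ ω, a ω k ∂P :=
    eval_integral_piLp (fun i => (hak i).integrable one_le_two) k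
  have hk (k : Fin d) : ∫ ω, a ω k ^ 2 ∂P ≤ (∫ ω, a ω ∂P) k ^ 2 + ζ ^ 2 := by
    have h := hvar k
    rw [hmean, ← ProbabilityTheory.variance_eq_integral (hak k).aemeasurable,
      ProbabilityTheory.variance_eq_sub (hak k)] at h
    simp only [Pi.pow_apply] at h
    rw [hmean]
    linarith
  simp only [EuclideanSpace.real_norm_sq_eq]
  rw [integral_finsetSum _ fun k _ => (hak k).integrable_sq]
  calc _ ≤ ∑ k, ((∫ ω, a ω ∂P) k ^ 2 + ζ ^ 2) := Finset.sum_le_sum fun k _ => hk k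
    _ = _ := by simp [Finset.sum_add_distrib]

/-- **Variance bound for the RGE (Proposition 2, eq. (7)).** -/
theorem rge_variance_bound
    (d : ℕ) (hd : 1 ≤ d)
    {Ω : Type} [MeasurableSpace Ω] (P : Measure Ω) [IsProbabilityMeasure P]
    (L ζ : ℝ) (hL : 0 ≤ L) (hζ : 0 ≤ ζ)
    (F : Euc d → Ω → ℝ)
    (hFmeas : Measurable (Function.uncurry F))
    (hFsmooth : ∀ᵐ ω ∂P, LSmooth (fun x => F x ω) L)
    (f : Euc d → ℝ) (hfdef : ∀ x, f x = ∫ ω, F x ω ∂P)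
    (hfsmooth : LSmooth f L)
    (hgradf : ∀ x, gradient f x = ∫ ω, gradient (fun y => F y ω) x ∂P)
    (hvar : ∀ (x : Euc d) (i : Fin d),
      ∫ ω, (gradient (fun y => F y ω) x i - gradient f x i) ^ 2 ∂P ≤ ζ ^ 2)
    (μr : ℝ) (hμr : 0 < μr) (nr br : ℕ) (hnr : 1 ≤ nr) (hbr : 1 ≤ br)
    (x : Euc d) :
    ∫ ω, ‖RGE F μr nr br x ω - gradient f x‖ ^ 2 ∂(RGEmeas d P nr br)
      ≤ (2 / (br : ℝ)) * (1 + (d : ℝ) / (nr : ℝ)) * (‖gradient f x‖ ^ 2 + (d : ℝ) * ζ ^ 2)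
        + (1 + 2 / (br : ℝ) + 2 / ((nr : ℝ) * (br : ℝ))) * (μr ^ 2 * L ^ 2 * (d : ℝ) ^ 2 / 4) := by
  have hb0 : (br : ℝ) ≠ 0 := by positivity
  set a : Ω → Euc d := fun ω => gradient (fun y => F y ω) x
  set R : ℝ := μr * L * d / 2 with hR
  set ν : Measure (Ω × (Fin nr → Euc d)) := P.prod (Measure.pi fun _ => sphereUniform d)
  set g : Ω × (Fin nr → Euc d) → Euc d := fun z => sampleRGE (fun y => F y z.1) μr nr x z.2
    with hg
  set ℓ : Ω × (Fin nr → Euc d) → Euc d := fun z => linearRGE nr (a z.1) z.2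
  have ha : AEStronglyMeasurable a P := aestronglyMeasurable_gradient
    (fun y => hFmeas.comp measurable_prodMk_left) x (hFsmooth.mono fun ω hω => hω.1 x)
  have hgmeas : AEStronglyMeasurable g ν := by
    refine Measurable.aestronglyMeasurable ?_
    have h1 (i : Fin nr) : Measurable fun z : Ω × (Fin nr → Euc d) => F (x + μr • z.2 i) z.1 :=
      hFmeas.comp (g := Function.uncurry F)
        (f := fun z : Ω × (Fin nr → Euc d) => (x + μr • z.2 i, z.1)) (by fun_prop)
    have h2 : Measurable fun z : Ω × (Fin nr → Euc d) => F x z.1 :=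
      hFmeas.comp (g := Function.uncurry F)
        (f := fun z : Ω × (Fin nr → Euc d) => (x, z.1)) (by fun_prop)
    simp only [hg, sampleRGE]
    fun_prop
  have hres : ∀ᵐ z ∂ν, ‖(g - ℓ) z‖ ≤ R := by
    filter_upwards [Measure.quasiMeasurePreserving_fst.ae hFsmooth,
      Measure.quasiMeasurePreserving_snd.ae (ae_pi_norm_eq_one hd nr)] with z hz hu
    exact norm_sampleRGE_sub_linearRGE_le hnr hz hμr x hu
  have hresLp : MemLp (g - ℓ) 2 ν :=
    MemLp.of_bound (hgmeas.sub (aestronglyMeasurable_linearRGE ha nr)) R hres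
  have hLHS : ∫ ω, ‖RGE F μr nr br x ω - gradient f x‖ ^ 2 ∂(RGEmeas d P nr br)
      = ∫ z, ‖(br : ℝ)⁻¹ • ∑ j, g (z j) - gradient f x‖ ^ 2
        ∂Measure.pi (fun _ : Fin br => ν) :=
    ((measurePreserving_arrowProdEquivProdArrow Ω (Fin nr → Euc d) (Fin br) (fun _ => P)
      fun _ => Measure.pi fun _ => sphereUniform d).integral_comp'
        fun ω => ‖RGE F μr nr br x ω - gradient f x‖ ^ 2).symm
  rw [hLHS]
  by_cases haLp : MemLp a 2 P
  · have hℓLp : MemLp ℓ 2 ν := memLp_linearRGE_prod hd hnr haLp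
    have hgLp : MemLp g 2 ν := by simpa using hresLp.add hℓLp
    have hsq : ∫ z, ‖g z‖ ^ 2 ∂ν
        ≤ 2 * ((1 + (d : ℝ) / nr) * (‖gradient f x‖ ^ 2 + d * ζ ^ 2)) + 2 * R ^ 2 := by
      have hpt : ∀ᵐ z ∂ν, ‖g z‖ ^ 2 ≤ 2 * ‖ℓ z‖ ^ 2 + 2 * R ^ 2 := by
        filter_upwards [hres] with z hz
        have h1 : ‖g z‖ ≤ ‖ℓ z‖ + R :=
          calc ‖g z‖ = ‖ℓ z + (g - ℓ) z‖ := by simp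
            _ ≤ ‖ℓ z‖ + R := (norm_add_le _ _).trans (by gcongr)
        nlinarith [norm_nonneg (g z), sq_nonneg (‖ℓ z‖ - R)]
      have hℓint := (hℓLp.integrable_norm_pow two_ne_zero).const_mul 2
      have h2 := integral_mono_ae (hgLp.integrable_norm_pow two_ne_zero)
        (hℓint.add (integrable_const (2 * R ^ 2))) hpt
      have h3 : ∫ z, (2 * ‖ℓ z‖ ^ 2 + 2 * R ^ 2) ∂ν = 2 * ∫ z, ‖ℓ z‖ ^ 2 ∂ν + 2 * R ^ 2 := by
        rw [integral_add hℓint (integrable_const _), integral_const_mul]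
        simp
      have h4 : ∫ z, ‖ℓ z‖ ^ 2 ∂ν ≤ (1 + (d : ℝ) / nr) * ∫ ω, ‖a ω‖ ^ 2 ∂P :=
        integral_norm_sq_linearRGE_prod_le hd hnr haLp
      have h5 : ∫ ω, ‖a ω‖ ^ 2 ∂P ≤ ‖gradient f x‖ ^ 2 + d * ζ ^ 2 := by
        rw [hgradf x]
        refine integral_norm_sq_le_of_coord_variance_le haLp fun i => ?_
        have := hvar x i
        rwa [hgradf x] at this
      have h6 : (1 + (d : ℝ) / nr) * ∫ ω, ‖a ω‖ ^ 2 ∂P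
          ≤ (1 + (d : ℝ) / nr) * (‖gradient f x‖ ^ 2 + d * ζ ^ 2) := by gcongr
      refine h2.trans (h3.trans_le ?_)
      linarith
    have hbias : ‖∫ z, g z ∂ν - gradient f x‖ ≤ R := by
      have hmean : ∫ z, ℓ z ∂ν = gradient f x := by
        rw [hgradf x]
        exact integral_linearRGE_prod hd hnr haLp
      rw [← hmean, ← integral_sub (hgLp.integrable one_le_two) (hℓLp.integrable one_le_two)]
      simpa using norm_integral_le_of_norm_le_const hres
    have hR2 : R ^ 2 = μr ^ 2 * L ^ 2 * (d : ℝ) ^ 2 / 4 := by rw [hR]; ring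
    have hextra : 0 ≤ 2 / ((nr : ℝ) * br) * R ^ 2 := by positivity
    calc _ ≤ (br : ℝ)⁻¹ * ∫ z, ‖g z‖ ^ 2 ∂ν + ‖∫ z, g z ∂ν - gradient f x‖ ^ 2 :=
          integral_norm_sq_mean_sub_le ν hbr hgLp _
      _ ≤ (br : ℝ)⁻¹ * (2 * ((1 + (d : ℝ) / nr) * (‖gradient f x‖ ^ 2 + d * ζ ^ 2)) + 2 * R ^ 2)
          + R ^ 2 := by gcongr
      _ = (2 / (br : ℝ)) * (1 + (d : ℝ) / nr) * (‖gradient f x‖ ^ 2 + d * ζ ^ 2)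
          + (1 + 2 / (br : ℝ)) * R ^ 2 := by ring
      _ ≤ _ := by rw [← hR2]; linarith
  · rw [integral_undef]
    · positivity
    · intro hInt
      refine haLp (memLp_of_memLp_linearRGE hd hnr ha ?_)
      have hgj (j : Fin br) : AEStronglyMeasurable (fun z : Fin br → Ω × (Fin nr → Euc d) => g (z j))
          (Measure.pi fun _ => ν) :=
        hgmeas.comp_measurePreserving (measurePreserving_eval (fun _ => ν) j)
      have hsummeas := Finset.aestronglyMeasurable_fun_sum univ fun j _ => hgj j
      have hmeanLp := (memLp_two_iff_integrable_sq_norm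
        ((hsummeas.const_smul (br : ℝ)⁻¹).sub aestronglyMeasurable_const)).2 hInt
      have hsumLp : MemLp (fun z => ∑ j, g (z j)) 2 (Measure.pi fun _ : Fin br => ν) := by
        refine ((hmeanLp.add (memLp_const (gradient f x))).const_smul (br : ℝ)).congr_norm hsummeas
          (.of_forall fun z => ?_)
        simp [hb0]
      have hgLp := memLp_of_memLp_sum_pi ν hbr hgmeas hsumLp
      simpa using hgLp.sub hresLp
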